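/- Converse part of the quantum Hoeffding bound (error-exponent form): let ρ and σ be faithful density operators on a finite-dimensional complex Hilbert space, let φ(s) := log Tr[ρ^{1−s}σ^{s}], and let b(r) := max_{0≤s<1} (−s·r − φ(s))/(1−s). Then for every r with 0 < r ≤ D(ρ‖σ) and every sequence of tests {T_n} (0 ≤ T_n ≤ I on the n-fold tensor power space): if limsup_{n→∞} (1/n)·log Tr[σ^{⊗n} T_n] ≤ −r, then liminf_{n→∞} (1/n)·log Tr[ρ^{⊗n}(I − T_n)] ≥ −b(r). -/

import Mathlib

open scoped Matrix ComplexOrder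
open Filter

noncomputable section

/-- Real power of a matrix, taken via the spectral decomposition when the matrix is
Hermitian (with the convention `0 ^ t` given by `Real.rpow`), and `0` otherwise. -/
def mpow {n : Type*} [Fintype n] [DecidableEq n] (A : Matrix n n ℂ) (t : ℝ) : Matrix n n ℂ :=
  if h : A.IsHermitian then
    (Matrix.IsHermitian.eigenvectorUnitary h : Matrix n n ℂ) *
      Matrix.diagonal (fun i => ((h.eigenvalues i ^ t : ℝ) : ℂ)) *
      (star (Matrix.IsHermitian.eigenvectorUnitary h : Matrix n n ℂ))
  else 0

/-- Logarithm of a matrix via the spectral decomposition (Hermitian case), `0` otherwise. -/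
def mlog {n : Type*} [Fintype n] [DecidableEq n] (A : Matrix n n ℂ) : Matrix n n ℂ :=
  if h : A.IsHermitian then
    (Matrix.IsHermitian.eigenvectorUnitary h : Matrix n n ℂ) *
      Matrix.diagonal (fun i => ((Real.log (h.eigenvalues i) : ℝ) : ℂ)) *
      (star (Matrix.IsHermitian.eigenvectorUnitary h : Matrix n n ℂ))
  else 0

/-- Exponential of a matrix via the spectral decomposition (Hermitian case), `0` otherwise. -/
def mexp {n : Type*} [Fintype n] [DecidableEq n] (A : Matrix n n ℂ) : Matrix n n ℂ :=
  if h : A.IsHermitian then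
    (Matrix.IsHermitian.eigenvectorUnitary h : Matrix n n ℂ) *
      Matrix.diagonal (fun i => ((Real.exp (h.eigenvalues i) : ℝ) : ℂ)) *
      (star (Matrix.IsHermitian.eigenvectorUnitary h : Matrix n n ℂ))
  else 0

/-- The orthogonal projection onto the span of the eigenvectors of a Hermitian matrix
corresponding to positive eigenvalues, denoted `{A > 0}` in the paper; `0` otherwise. -/
def posProj {n : Type*} [Fintype n] [DecidableEq n] (A : Matrix n n ℂ) : Matrix n n ℂ :=
  if h : A.IsHermitian then
    (Matrix.IsHermitian.eigenvectorUnitary h : Matrix n n ℂ) *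
      Matrix.diagonal (fun i => if 0 < h.eigenvalues i then (1 : ℂ) else 0) *
      (star (Matrix.IsHermitian.eigenvectorUnitary h : Matrix n n ℂ))
  else 0

/-- The `n`-fold tensor (Kronecker) power `ρ^{⊗n}`, as a matrix indexed by `Fin n → Fin d`. -/
def tensorPow {d : ℕ} (ρ : Matrix (Fin d) (Fin d) ℂ) (n : ℕ) :
    Matrix (Fin n → Fin d) (Fin n → Fin d) ℂ :=
  fun v w => ∏ t, ρ (v t) (w t)

/-- Quantum relative entropy `D(ρ‖σ) = Tr[ρ(log ρ − log σ)]`. -/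
def qRelEnt {d : ℕ} (ρ σ : Matrix (Fin d) (Fin d) ℂ) : ℝ :=
  ((ρ * (mlog ρ - mlog σ)).trace).re

/-- `φ(s | ρ‖σ) = log Tr[ρ^{1−s} σ^{s}]`. -/
def qphi {d : ℕ} (ρ σ : Matrix (Fin d) (Fin d) ℂ) (s : ℝ) : ℝ :=
  Real.log (((mpow ρ (1 - s)) * (mpow σ s)).trace.re)


lemma hoeff_opt (φ : ℝ → ℝ) (hφ : ContDiff ℝ 1 φ) (h0 : φ 0 = 0) (h1 : φ 1 = 0)
    (r : ℝ) (hr : 0 < r) (ε : ℝ) (hε : 0 < ε) :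
    ∃ s, 0 < s ∧ s < 1 ∧ -(1-s) * deriv φ s - φ s < r ∧
      s * deriv φ s - φ s < (⨆ s : Set.Ico (0:ℝ) 1, (-(s:ℝ)*r - φ s)/(1-(s:ℝ))) + ε := by
  have hc : Continuous φ := hφ.continuous
  have hdiff : Differentiable ℝ φ := hφ.differentiable (by simp)
  have hdc : Continuous (deriv φ) := hφ.continuous_deriv (by simp)
  set f : ℝ → ℝ := fun s => (-s * r - φ s) / (1 - s) with hf
  have hfc : ∀ s, s < 1 → ContinuousAt f s := by
    intro s hs
    have : (1 : ℝ) - s ≠ 0 := by linarith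
    exact ContinuousAt.div (by fun_prop) (by fun_prop) this
  obtain ⟨c, hc0, hc1, hcneg⟩ : ∃ c : ℝ, 0 < c ∧ c < 1 ∧ ∀ s, c < s → s < 1 → f s < 0 := by
    have hg : ContinuousAt (fun s : ℝ => -s * r - φ s) 1 := by fun_prop
    have hev : ∀ᶠ s in nhds (1:ℝ), -s * r - φ s < 0 :=
      hg.eventually_lt continuousAt_const (by simp [h1, hr])
    obtain ⟨δ, hδ, h⟩ := Metric.eventually_nhds_iff.1 hev
    refine ⟨max (1/2) (1 - δ), by positivity, max_lt (by norm_num) (by linarith), ?_⟩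
    intro s hs hs1
    have h2 := lt_of_le_of_lt (le_max_right _ _) hs
    refine div_neg_of_neg_of_pos (h ?_) (by linarith)
    rw [Real.dist_eq, abs_lt]; constructor <;> linarith
  have hcon : ContinuousOn f (Set.Icc 0 c) := fun s hs =>
    (hfc s (by linarith [hs.2])).continuousWithinAt
  obtain ⟨s0, hs0, hmax⟩ := isCompact_Icc.exists_isMaxOn (Set.nonempty_Icc.2 hc0.le) hcon
  have hf0 : f 0 = 0 := by simp [hf, h0]
  have hM0 : 0 ≤ f s0 := by
    rw [← hf0]; exact hmax (Set.left_mem_Icc.2 hc0.le)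
  have hM : ∀ s, 0 ≤ s → s < 1 → f s ≤ f s0 := by
    intro s h h'
    rcases le_or_gt s c with hsc | hsc
    · exact hmax ⟨h, hsc⟩
    · exact (hcneg s hsc h').le.trans hM0
  have hbdd : BddAbove (Set.range fun s : Set.Ico (0:ℝ) 1 => f s) := by
    refine ⟨f s0, ?_⟩
    rintro _ ⟨s, rfl⟩
    exact hM s s.2.1 s.2.2
  have hcomp : IsCompact (Set.Icc 0 c ∩ f ⁻¹' {f s0}) :=
    isCompact_Icc.of_isClosed_subset
      (hcon.preimage_isClosed_of_isClosed isClosed_Icc isClosed_singleton) Set.inter_subset_left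
  obtain ⟨t, ⟨⟨ht0, htc⟩, htM⟩, htmax⟩ := hcomp.exists_isGreatest ⟨s0, hs0, rfl⟩
  have htM : f t = f s0 := htM
  have ht1 : t < 1 := by linarith
  have hlt : ∀ s, t < s → s < 1 → f s < f t := by
    intro s h h'
    rw [htM]
    rcases le_or_gt s c with hsc | hsc
    · refine lt_of_le_of_ne (hM s (by linarith) h') ?_
      intro he
      have := htmax ⟨⟨by linarith, hsc⟩, he⟩
      linarith
    · exact (hcneg s hsc h').trans_le hM0
  set D : ℝ → ℝ := fun s => -(1-s) * deriv φ s - φ s with hD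
  have hder : ∀ s, s < 1 → HasDerivAt f ((D s - r) / (1-s)^2) s := by
    intro s hs
    have hne : (1 : ℝ) - s ≠ 0 := by linarith
    have a1 : HasDerivAt (fun s : ℝ => -s * r - φ s) (-1 * r - deriv φ s) s :=
      ((hasDerivAt_id s).neg.mul_const r).sub (hdiff s).hasDerivAt
    have a2 : HasDerivAt (fun s : ℝ => 1 - s) (-1) s := by
      simpa using (hasDerivAt_id s).const_sub 1
    have a3 : HasDerivAt f (((-1 * r - deriv φ s) * (1 - s) - (-s * r - φ s) * -1) / (1 - s) ^ 2) s :=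
      a1.div a2 hne
    have e : (D s - r) / (1 - s) ^ 2 =
        ((-1 * r - deriv φ s) * (1 - s) - (-s * r - φ s) * -1) / (1 - s) ^ 2 := by
      simp only [hD]; congr 1; ring
    rw [e]; exact a3
  have hzero : t * (r - D t) / (1 - t) = 0 := by
    rcases ht0.eq_or_lt with h | h
    · simp [← h]
    · have hloc : IsLocalMax f t := by
        filter_upwards [Ioo_mem_nhds h ht1] with s hs
        rw [htM]; exact hM s hs.1.le hs.2
      have h2 := hloc.hasDerivAt_eq_zero (hder t ht1)
      have hne : (1 : ℝ) - t ≠ 0 := by linarith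
      have : D t - r = 0 := by
        rcases div_eq_zero_iff.1 h2 with h3 | h3
        · exact h3
        · exact absurd (pow_eq_zero_iff (two_ne_zero) |>.1 h3) hne
      have : r - D t = 0 := by linarith
      simp [this]
  have hDc : Continuous D := by simp only [hD]; fun_prop
  have hev : ∀ᶠ s in nhds t, s * (r - D s) / (1 - s) < ε := by
    have : ContinuousAt (fun s => s * (r - D s) / (1 - s)) t :=
      ContinuousAt.div (by fun_prop) (by fun_prop) (by linarith)
    exact this.eventually_lt continuousAt_const (by simpa [hzero] using hε)
  obtain ⟨δ, hδ, h⟩ := Metric.eventually_nhds_iff.1 hev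
  obtain ⟨v, hv1, hv2⟩ : ∃ v, t < v ∧ v < min 1 (t + δ) := exists_between (lt_min ht1 (by linarith))
  have hv3 := hv2.trans_le (min_le_left _ _)
  have hv4 := hv2.trans_le (min_le_right _ _)
  obtain ⟨ξ, hξ, hξs⟩ := exists_hasDerivAt_eq_slope f (fun s => (D s - r) / (1-s)^2) hv1
    (fun s hs => (hfc s (by linarith [hs.2])).continuousWithinAt)
    (fun s hs => hder s (by linarith [hs.2]))
  have hξ1 : ξ < 1 := by linarith [hξ.2]
  have hneg : (D ξ - r) / (1 - ξ)^2 < 0 := by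
    rw [hξs]; exact div_neg_of_neg_of_pos (by linarith [hlt v hv1 hv3]) (by linarith)
  have hDr : D ξ < r := by
    by_contra hcon
    have : 0 ≤ (D ξ - r) / (1 - ξ)^2 := div_nonneg (by linarith) (sq_nonneg _)
    linarith
  have hξ0 : 0 < ξ := by linarith [hξ.1]
  refine ⟨ξ, hξ0, hξ1, hDr, ?_⟩
  have hb : f ξ ≤ ⨆ s : Set.Ico (0:ℝ) 1, f s := le_ciSup hbdd ⟨ξ, hξ0.le, hξ1⟩
  have he : ξ * (r - D ξ) / (1 - ξ) < ε := by
    apply h; rw [Real.dist_eq, abs_lt]; constructor <;> linarith [hξ.1, hξ.2]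
  have hid : ξ * deriv φ ξ - φ ξ = f ξ + ξ * (r - D ξ) / (1 - ξ) := by
    have hne : (1 : ℝ) - ξ ≠ 0 := by linarith
    simp only [hf, hD]; field_simp; ring
  rw [hid]
  exact add_lt_add_of_le_of_lt hb he


lemma hoeff_sum_prod {K : Type*} [Fintype K] (F : K → ℝ) (n : ℕ) :
    ∑ g : Fin n → K, ∏ t, F (g t) = (∑ k, F k) ^ n := by
  rw [← Fintype.prod_sum]; simp

/-- Pointwise tilting inequality. -/
lemma hoeff_pointwise (s θ m η N x y : ℝ) (hs0 : 0 ≤ s) (hs1 : s ≤ 1) (hθ : 0 < θ)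
    (hη : 0 < η) (hN : 0 ≤ N) :
    Real.exp ((1-s)*x + s*y) ≤ Real.exp (-(N*(s*m-η))) *
        min (Real.exp x) (Real.exp (N*m) * Real.exp y)
      + Real.exp (-(N*(θ*(m+η)))) * Real.exp ((1-(s-θ))*x + (s-θ)*y)
      + Real.exp (N*(θ*(m-η))) * Real.exp ((1-(s+θ))*x + (s+θ)*y) := by
  rcases lt_or_ge (N*(m+η)) (x-y) with h | h
  · have : Real.exp ((1-s)*x + s*y) ≤
        Real.exp (-(N*(θ*(m+η)))) * Real.exp ((1-(s-θ))*x + (s-θ)*y) := by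
      rw [← Real.exp_add]; apply Real.exp_le_exp.2
      nlinarith
    have : 0 ≤ Real.exp (-(N*(s*m-η))) * min (Real.exp x) (Real.exp (N*m) * Real.exp y) := by
      positivity
    have : 0 ≤ Real.exp (N*(θ*(m-η))) * Real.exp ((1-(s+θ))*x + (s+θ)*y) := by positivity
    linarith
  rcases lt_or_ge (x-y) (N*(m-η)) with h' | h'
  · have : Real.exp ((1-s)*x + s*y) ≤
        Real.exp (N*(θ*(m-η))) * Real.exp ((1-(s+θ))*x + (s+θ)*y) := by
      rw [← Real.exp_add]; apply Real.exp_le_exp.2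
      nlinarith
    have : 0 ≤ Real.exp (-(N*(s*m-η))) * min (Real.exp x) (Real.exp (N*m) * Real.exp y) := by
      positivity
    have : 0 ≤ Real.exp (-(N*(θ*(m+η)))) * Real.exp ((1-(s-θ))*x + (s-θ)*y) := by positivity
    linarith
  · have : Real.exp ((1-s)*x + s*y) ≤
        Real.exp (-(N*(s*m-η))) * min (Real.exp x) (Real.exp (N*m) * Real.exp y) := by
      rw [mul_min_of_nonneg _ _ (Real.exp_pos _).le, ← Real.exp_add, ← Real.exp_add,
        ← Real.exp_add]
      have hNη : 0 ≤ N * η := by positivity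
      refine le_min (Real.exp_le_exp.2 ?_) (Real.exp_le_exp.2 ?_)
      · nlinarith [mul_le_mul_of_nonneg_left h' hs0, mul_nonneg (sub_nonneg.2 hs1) hNη]
      · nlinarith [mul_le_mul_of_nonneg_left h (sub_nonneg.2 hs1), mul_nonneg hs0 hNη]
    have : 0 ≤ Real.exp (-(N*(θ*(m+η)))) * Real.exp ((1-(s-θ))*x + (s-θ)*y) := by positivity
    have : 0 ≤ Real.exp (N*(θ*(m-η))) * Real.exp ((1-(s+θ))*x + (s+θ)*y) := by positivity
    linarith

lemma hoeff_class {K : Type*} [Fintype K] (w l u : K → ℝ) (hw : ∀ k, 0 ≤ w k) (Z : ℝ → ℝ)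
    (hZ : ∀ s, Z s = ∑ k, w k * Real.exp ((1-s) * l k + s * u k)) (hpos : ∀ s, 0 < Z s)
    (s : ℝ) (hs0 : 0 ≤ s) (hs1 : s ≤ 1) (m : ℝ)
    (hm : HasDerivAt (fun s => Real.log (Z s)) (-m) s) (η : ℝ) (hη : 0 < η) :
    ∀ᶠ n : ℕ in atTop, (1/2) * Real.exp (n * (Real.log (Z s) + s * m - η)) ≤
      ∑ g : Fin n → K, (∏ t, w (g t)) *
        min (Real.exp (∑ t, l (g t))) (Real.exp (n * m) * Real.exp (∑ t, u (g t))) := by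
  -- choose θ
  obtain ⟨θ, hθ, hθ1, hθ2⟩ : ∃ θ > 0, Real.log (Z (s-θ)) < Real.log (Z s) + θ*(m+η) ∧
      Real.log (Z (s+θ)) < Real.log (Z s) - θ*(m-η) := by
    have := (hasDerivAt_iff_isLittleO.1 hm).def (half_pos hη)
    obtain ⟨δ, hδ, h⟩ := Metric.eventually_nhds_iff.1 this
    refine ⟨δ/2, by positivity, ?_, ?_⟩
    · have h1 := @h (s - δ/2) (by rw [Real.dist_eq, abs_lt]; constructor <;> linarith)
      simp only [smul_eq_mul, Real.norm_eq_abs, sub_sub_cancel_left, abs_neg,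
        abs_of_pos (half_pos hδ)] at h1
      have h2 := (abs_le.1 h1).2
      nlinarith
    · have h1 := @h (s + δ/2) (by rw [Real.dist_eq, abs_lt]; constructor <;> linarith)
      simp only [smul_eq_mul, Real.norm_eq_abs, add_sub_cancel_left,
        abs_of_pos (half_pos hδ)] at h1
      have h2 := (abs_le.1 h1).2
      nlinarith
  set a1 := Real.exp (-(θ*(m+η))) * Z (s-θ) with ha1
  set a2 := Real.exp (θ*(m-η)) * Z (s+θ) with ha2
  have hlt1 : a1 < Z s := by
    rw [ha1, ← Real.exp_log (hpos (s-θ)), ← Real.exp_add]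
    conv_rhs => rw [← Real.exp_log (hpos s)]
    apply Real.exp_lt_exp.2; linarith
  have hlt2 : a2 < Z s := by
    rw [ha2, ← Real.exp_log (hpos (s+θ)), ← Real.exp_add]
    conv_rhs => rw [← Real.exp_log (hpos s)]
    apply Real.exp_lt_exp.2; linarith
  have key : ∀ a, 0 < a → a < Z s → ∀ᶠ n : ℕ in atTop, a ^ n ≤ (1/4) * (Z s) ^ n := by
    intro a ha hlt
    have h := tendsto_pow_atTop_nhds_zero_of_lt_one (r := a / Z s)
      (div_nonneg ha.le (hpos s).le) ((div_lt_one (hpos s)).2 hlt)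
    filter_upwards [h.eventually_le_const (show (0:ℝ) < 1/4 by norm_num)] with n hn
    rw [div_pow, div_le_iff₀ (pow_pos (hpos s) n)] at hn
    exact hn
  filter_upwards [key a1 (mul_pos (Real.exp_pos _) (hpos _)) hlt1,
    key a2 (mul_pos (Real.exp_pos _) (hpos _)) hlt2] with n hn1 hn2
  set M := ∑ g : Fin n → K, (∏ t, w (g t)) *
        min (Real.exp (∑ t, l (g t))) (Real.exp (n * m) * Real.exp (∑ t, u (g t))) with hM
  have hZn : ∀ s, ∑ g : Fin n → K, (∏ t, w (g t)) *
      Real.exp ((1-s) * (∑ t, l (g t)) + s * (∑ t, u (g t))) = Z s ^ n := by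
    intro s
    rw [hZ, ← hoeff_sum_prod]
    refine Finset.sum_congr rfl fun g _ => ?_
    rw [Finset.prod_mul_distrib, ← Real.exp_sum, Finset.sum_add_distrib, Finset.mul_sum,
      Finset.mul_sum]
  have main : Z s ^ n ≤ Real.exp (-(n*(s*m-η))) * M + a1 ^ n + a2 ^ n := by
    rw [ha1, ha2, mul_pow, mul_pow, ← Real.exp_nat_mul, ← Real.exp_nat_mul, ← hZn, ← hZn, ← hZn,
      hM, Finset.mul_sum, Finset.mul_sum, Finset.mul_sum, ← Finset.sum_add_distrib,
      ← Finset.sum_add_distrib]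
    refine Finset.sum_le_sum fun g _ => ?_
    have := mul_le_mul_of_nonneg_left (hoeff_pointwise s θ m η n (∑ t, l (g t)) (∑ t, u (g t))
      hs0 hs1 hθ hη n.cast_nonneg) (Finset.prod_nonneg (fun t (_ : t ∈ Finset.univ) => hw (g t)))
    refine this.trans (le_of_eq ?_)
    rw [mul_neg (n : ℝ) (θ * (m+η))]
    ring
  have h3 : (1/2) * Z s ^ n ≤ Real.exp (-(n*(s*m-η))) * M := by linarith
  have h4 := mul_le_mul_of_nonneg_left h3 (Real.exp_pos (n*(s*m-η))).le
  rw [← mul_assoc, ← mul_assoc, ← Real.exp_add, add_neg_cancel, Real.exp_zero, one_mul] at h4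
  refine le_trans (le_of_eq ?_) h4
  have : Real.exp (n * (Real.log (Z s) + s * m - η)) = Real.exp (n*(s*m-η)) * Z s ^ n := by
    conv_rhs => rw [← Real.exp_log (hpos s)]
    rw [← Real.exp_nat_mul, ← Real.exp_add]
    congr 1; ring
  rw [this]; ring

lemma hoeff_trace_diag {N : Type*} [Fintype N] [DecidableEq N] (U A : Matrix N N ℂ) (lam : N → ℝ) :
    ((U * Matrix.diagonal (fun i => (lam i : ℂ)) * Uᴴ * A).trace).re
      = ∑ i, lam i * ((Uᴴ * A * U) i i).re := by
  rw [Matrix.mul_assoc, Matrix.mul_assoc, Matrix.trace_mul_comm, Matrix.mul_assoc, Matrix.trace]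
  simp [Matrix.diagonal_mul, Matrix.mul_assoc]

lemma hoeff_psd_mul_self {N : Type*} [Fintype N] [DecidableEq N] (S T : Matrix N N ℂ)
    (hS : S.PosSemidef) (hT : T.PosSemidef) (h : S + T = 1) : (S - S * S).PosSemidef := by
  have e : T = 1 - S := by rw [← h]; abel
  have : S - S * S = Sᴴ * T * S + Tᴴ * S * T := by
    rw [hS.1.eq, hT.1.eq, e]; noncomm_ring
  rw [this]
  exact (hT.conjTranspose_mul_mul_same S).add (hS.conjTranspose_mul_mul_same T)

lemma hoeff_test_sq {N : Type*} [Fintype N] [DecidableEq N] (U S T : Matrix N N ℂ) (lam : N → ℝ)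
    (hl : ∀ i, 0 ≤ lam i)
    (hS : S.PosSemidef) (hT : T.PosSemidef) (h : S + T = 1) (V : Matrix N N ℂ) (hV : V * Vᴴ = 1) :
    ∑ i, ∑ j, lam i * Complex.normSq ((Uᴴ * S * V) i j) ≤
      ((U * Matrix.diagonal (fun i => (lam i : ℂ)) * Uᴴ * S).trace).re := by
  rw [hoeff_trace_diag]
  refine Finset.sum_le_sum fun i _ => ?_
  rw [← Finset.mul_sum]
  refine mul_le_mul_of_nonneg_left ?_ (hl i)
  have h1 := ((hoeff_psd_mul_self S T hS hT h).conjTranspose_mul_mul_same U).diag_nonneg (i := i)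
  have h2 : Uᴴ * (S - S * S) * U = Uᴴ * S * U - (Uᴴ * S * V) * (Uᴴ * S * V)ᴴ := by
    rw [Matrix.conjTranspose_mul, Matrix.conjTranspose_mul, Matrix.conjTranspose_conjTranspose,
      hS.1.eq, Matrix.mul_sub, Matrix.sub_mul]
    congr 1
    calc Uᴴ * (S * S) * U = Uᴴ * S * 1 * S * U := by simp only [Matrix.mul_assoc, Matrix.one_mul]
      _ = _ := by rw [← hV]; simp only [Matrix.mul_assoc]
  rw [h2, Matrix.sub_apply] at h1
  have h3 := (Complex.nonneg_iff.1 h1).1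
  rw [Complex.sub_re, sub_nonneg] at h3
  refine le_trans (le_of_eq ?_) h3
  rw [Matrix.mul_apply, Complex.re_sum]
  refine Finset.sum_congr rfl fun j _ => ?_
  rw [Matrix.conjTranspose_apply]
  simp [Complex.normSq_apply]

lemma hoeff_test {N : Type*} [Fintype N] [DecidableEq N] (U V T : Matrix N N ℂ) (lam mu : N → ℝ)
    (hl : ∀ i, 0 ≤ lam i) (hm : ∀ i, 0 ≤ mu i) (hU : U * Uᴴ = 1) (hV : V * Vᴴ = 1)
    (hT : T.PosSemidef) (hT1 : (1 - T).PosSemidef) (δ : ℝ) (hδ : 0 ≤ δ) :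
    (1/2) * ∑ i, ∑ j, Complex.normSq ((Uᴴ * V) i j) * min (lam i) (δ * mu j) ≤
      ((U * Matrix.diagonal (fun i => (lam i : ℂ)) * Uᴴ * (1 - T)).trace).re +
      δ * ((V * Matrix.diagonal (fun i => (mu i : ℂ)) * Vᴴ * T).trace).re := by
  have h1 := hoeff_test_sq U (1 - T) T lam hl hT1 hT (by abel) V hV
  have h2 := hoeff_test_sq V T (1 - T) mu hm hT hT1 (by abel) U hU
  rw [Finset.sum_comm] at h2
  refine le_trans ?_ (add_le_add h1 (mul_le_mul_of_nonneg_left h2 hδ))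
  rw [Finset.mul_sum, Finset.mul_sum, ← Finset.sum_add_distrib]
  refine Finset.sum_le_sum fun i _ => ?_
  rw [Finset.mul_sum, Finset.mul_sum, ← Finset.sum_add_distrib]
  refine Finset.sum_le_sum fun j _ => ?_
  have e1 : (Uᴴ * V) i j = (Uᴴ * (1 - T) * V) i j + (Uᴴ * T * V) i j := by
    rw [← Matrix.add_apply, ← Matrix.add_mul, ← Matrix.mul_add]; simp
  have e2 : Complex.normSq ((Vᴴ * T * U) j i) = Complex.normSq ((Uᴴ * T * V) i j) := by
    have : Vᴴ * T * U = (Uᴴ * T * V)ᴴ := by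
      rw [Matrix.conjTranspose_mul, Matrix.conjTranspose_mul, Matrix.conjTranspose_conjTranspose,
        hT.1.eq, Matrix.mul_assoc]
    rw [this, Matrix.conjTranspose_apply]
    exact Complex.normSq_conj _
  rw [e1, e2]
  generalize (Uᴴ * (1 - T) * V) i j = a
  generalize (Uᴴ * T * V) i j = c
  have h3 : Complex.normSq (a + c) ≤ 2 * (Complex.normSq a + Complex.normSq c) := by
    simp only [Complex.normSq_apply, Complex.add_re, Complex.add_im]
    nlinarith [sq_nonneg (a.re - c.re), sq_nonneg (a.im - c.im)]
  have h4 : 0 ≤ min (lam i) (δ * mu j) := le_min (hl i) (mul_nonneg hδ (hm j))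
  have h5 := min_le_left (lam i) (δ * mu j)
  have h6 := min_le_right (lam i) (δ * mu j)
  have h7 := mul_le_mul_of_nonneg_right h3 h4
  have h8 := mul_le_mul_of_nonneg_right h5 (Complex.normSq_nonneg a)
  have h9 := mul_le_mul_of_nonneg_right h6 (Complex.normSq_nonneg c)
  nlinarith

lemma hoeff_tp_mul {d : ℕ} (A B : Matrix (Fin d) (Fin d) ℂ) (n : ℕ) :
    tensorPow (A * B) n = tensorPow A n * tensorPow B n := by
  ext v w
  simp only [tensorPow, Matrix.mul_apply, ← Finset.prod_mul_distrib]
  rw [Fintype.prod_sum]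

lemma hoeff_tp_diag {d : ℕ} (a : Fin d → ℝ) (n : ℕ) :
    tensorPow (Matrix.diagonal (fun i => (a i : ℂ))) n =
      Matrix.diagonal (fun v : Fin n → Fin d => ((∏ t, a (v t) : ℝ) : ℂ)) := by
  ext v w
  by_cases h : v = w
  · subst h; simp [tensorPow]
  · rw [Matrix.diagonal_apply_ne _ h]
    obtain ⟨t, ht⟩ := Function.ne_iff.1 h
    exact Finset.prod_eq_zero (Finset.mem_univ t) (Matrix.diagonal_apply_ne _ ht)

lemma hoeff_tp_one {d : ℕ} (n : ℕ) : tensorPow (1 : Matrix (Fin d) (Fin d) ℂ) n = 1 := by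
  have := hoeff_tp_diag (d := d) (fun _ => 1) n
  simpa using this

lemma hoeff_tp_conj {d : ℕ} (A : Matrix (Fin d) (Fin d) ℂ) (n : ℕ) :
    tensorPow Aᴴ n = (tensorPow A n)ᴴ := by
  ext v w
  simp [tensorPow, Matrix.conjTranspose_apply]

lemma hoeff_tp_trace {d : ℕ} (A : Matrix (Fin d) (Fin d) ℂ) (n : ℕ) :
    (tensorPow A n).trace = A.trace ^ n := by
  simp only [Matrix.trace, tensorPow, Matrix.diag]
  rw [← Fintype.prod_sum (fun (_ : Fin n) i => A i i)]; simp

/-- Spectral data of a positive definite matrix. -/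
lemma hoeff_spec {d : ℕ} (A : Matrix (Fin d) (Fin d) ℂ) (hA : A.PosDef) :
    ∃ (U : Matrix (Fin d) (Fin d) ℂ) (l : Fin d → ℝ), U * Uᴴ = 1 ∧
      (A = U * Matrix.diagonal (fun i => ((Real.exp (l i) : ℝ) : ℂ)) * Uᴴ) ∧
      ∀ t, mpow A t = U * Matrix.diagonal (fun i => ((Real.exp (t * l i) : ℝ) : ℂ)) * Uᴴ := by
  have hp := hA.eigenvalues_pos
  refine ⟨hA.1.eigenvectorUnitary, fun i => Real.log (hA.1.eigenvalues i), ?_, ?_, ?_⟩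
  · exact Unitary.coe_mul_star_self _
  · have := hA.1.spectral_theorem
    rw [Unitary.conjStarAlgAut_apply] at this
    conv_lhs => rw [this]
    congr 3
    ext i
    simp [Real.exp_log (hp i)]
  · intro t
    rw [mpow, dif_pos hA.1]
    congr 3
    ext i
    rw [Real.rpow_def_of_pos (hp i), mul_comm]

lemma hoeff_trace_mpow {d : ℕ} (U V : Matrix (Fin d) (Fin d) ℂ) (a c : Fin d → ℝ) :
    ((U * Matrix.diagonal (fun i => (a i : ℂ)) * Uᴴ *
      (V * Matrix.diagonal (fun i => (c i : ℂ)) * Vᴴ)).trace).re =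
    ∑ i, ∑ j, Complex.normSq ((Uᴴ * V) i j) * (a i * c j) := by
  rw [hoeff_trace_diag]
  refine Finset.sum_congr rfl fun i _ => ?_
  have : Uᴴ * (V * Matrix.diagonal (fun i => (c i : ℂ)) * Vᴴ) * U =
      (Uᴴ * V) * Matrix.diagonal (fun i => (c i : ℂ)) * (Uᴴ * V)ᴴ := by
    rw [Matrix.conjTranspose_mul, Matrix.conjTranspose_conjTranspose]
    simp only [Matrix.mul_assoc]
  rw [this, Matrix.mul_apply, Complex.re_sum, Finset.mul_sum]
  refine Finset.sum_congr rfl fun j _ => ?_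
  rw [Matrix.mul_diagonal, Matrix.conjTranspose_apply]
  simp [Complex.normSq_apply]
  ring

lemma hoeff_tp_spec {d : ℕ} (A U : Matrix (Fin d) (Fin d) ℂ) (l : Fin d → ℝ)
    (hA : A = U * Matrix.diagonal (fun i => ((Real.exp (l i) : ℝ) : ℂ)) * Uᴴ) (n : ℕ) :
    tensorPow A n = tensorPow U n * Matrix.diagonal (fun v : Fin n → Fin d =>
      ((Real.exp (∑ t, l (v t)) : ℝ) : ℂ)) * (tensorPow U n)ᴴ := by
  conv_lhs => rw [hA]
  rw [hoeff_tp_mul, hoeff_tp_mul, hoeff_tp_diag, hoeff_tp_conj]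
  simp only [Real.exp_sum]

lemma hoeff_tp_unit {d : ℕ} (U : Matrix (Fin d) (Fin d) ℂ) (hU : U * Uᴴ = 1) (n : ℕ) :
    tensorPow U n * (tensorPow U n)ᴴ = 1 := by
  rw [← hoeff_tp_conj, ← hoeff_tp_mul, hU, hoeff_tp_one]

lemma hoeff_trace_nonneg {d : ℕ} (A : Matrix (Fin d) (Fin d) ℂ) (hA : A.PosDef) (n : ℕ)
    (S T : Matrix (Fin n → Fin d) (Fin n → Fin d) ℂ)
    (hS : S.PosSemidef) (hT : T.PosSemidef) (h : S + T = 1) :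
    0 ≤ ((tensorPow A n * S).trace).re := by
  obtain ⟨U, l, hU, hAU, -⟩ := hoeff_spec A hA
  rw [hoeff_tp_spec A U l hAU]
  refine le_trans ?_ (hoeff_test_sq (tensorPow U n) S T (fun v => Real.exp (∑ t, l (v t)))
    (fun _ => (Real.exp_pos _).le) hS hT h _ (hoeff_tp_unit U hU n))
  exact Finset.sum_nonneg fun i _ => Finset.sum_nonneg fun j _ =>
    mul_nonneg (Real.exp_pos _).le (Complex.normSq_nonneg _)

lemma hoeff_min {d : ℕ} (A B U V : Matrix (Fin d) (Fin d) ℂ) (l u : Fin d → ℝ)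
    (hA : A = U * Matrix.diagonal (fun i => ((Real.exp (l i) : ℝ) : ℂ)) * Uᴴ)
    (hB : B = V * Matrix.diagonal (fun i => ((Real.exp (u i) : ℝ) : ℂ)) * Vᴴ)
    (hU : U * Uᴴ = 1) (hV : V * Vᴴ = 1) (n : ℕ)
    (T : Matrix (Fin n → Fin d) (Fin n → Fin d) ℂ)
    (hT : T.PosSemidef) (hT1 : (1 - T).PosSemidef) (δ : ℝ) (hδ : 0 ≤ δ) :
    (1/2) * ∑ g : Fin n → Fin d × Fin d,
      (∏ t, Complex.normSq ((Uᴴ * V) (g t).1 (g t).2)) *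
        min (Real.exp (∑ t, l (g t).1)) (δ * Real.exp (∑ t, u (g t).2)) ≤
      ((tensorPow A n * (1 - T)).trace).re + δ * ((tensorPow B n * T).trace).re := by
  rw [hoeff_tp_spec A U l hA, hoeff_tp_spec B V u hB]
  refine le_trans (le_of_eq ?_) (hoeff_test (tensorPow U n) (tensorPow V n) T
    (fun v => Real.exp (∑ t, l (v t))) (fun v => Real.exp (∑ t, u (v t)))
    (fun _ => (Real.exp_pos _).le) (fun _ => (Real.exp_pos _).le)
    (hoeff_tp_unit U hU n) (hoeff_tp_unit V hV n) hT hT1 δ hδ)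
  congr 1
  rw [← hoeff_tp_conj, ← hoeff_tp_mul, ← Fintype.sum_prod_type']
  refine Fintype.sum_equiv (Equiv.arrowProdEquivProdArrow (Fin n) (fun _ => Fin d)
    (fun _ => Fin d)) _ _ fun g => ?_
  simp [tensorPow, Equiv.arrowProdEquivProdArrow, map_prod]

/-- Converse part of the quantum Hoeffding bound (error-exponent form): for
`0 < r ≤ D(ρ‖σ)`, if `limsup (1/n)·log βₙ[Tₙ] ≤ −r` then
`liminf (1/n)·log αₙ[Tₙ] ≥ −b(r)`, where `b(r) = max_{0≤s<1}(−s·r − φ(s))/(1−s)`. -/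
theorem converse_hoeffding {d : ℕ} (ρ σ : Matrix (Fin d) (Fin d) ℂ)
    (hρ : ρ.PosDef) (hρ1 : ρ.trace = 1)
    (hσ : σ.PosDef) (hσ1 : σ.trace = 1)
    (b : ℝ → ℝ)
    (hb : ∀ r, b r = ⨆ s : Set.Ico (0 : ℝ) 1, (-(s : ℝ) * r - qphi ρ σ (s : ℝ)) / (1 - (s : ℝ)))
    (r : ℝ) (hr1 : 0 < r) (hr2 : r ≤ qRelEnt ρ σ)
    (T : (n : ℕ) → Matrix (Fin n → Fin d) (Fin n → Fin d) ℂ)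
    (hT : ∀ n, (T n).PosSemidef ∧ (1 - T n).PosSemidef)
    (hβ : limsup (fun n : ℕ =>
        (1 / (n : ℝ)) * Real.log (((tensorPow σ n * T n).trace).re)) atTop ≤ -r) :
    -(b r) ≤ liminf (fun n : ℕ =>
        (1 / (n : ℝ)) * Real.log (((tensorPow ρ n * (1 - T n)).trace).re)) atTop := by
  obtain ⟨U, l, hU, hAU, hmU⟩ := hoeff_spec ρ hρ
  obtain ⟨V, u, hV, hBV, hmV⟩ := hoeff_spec σ hσ
  set w : Fin d × Fin d → ℝ := fun k => Complex.normSq ((Uᴴ * V) k.1 k.2) with hw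
  have hw0 : ∀ k, 0 ≤ w k := fun k => Complex.normSq_nonneg _
  set Z : ℝ → ℝ := fun s => ∑ k : Fin d × Fin d,
    w k * Real.exp ((1-s) * l k.1 + s * u k.2) with hZ
  have hZeq : ∀ s, (mpow ρ (1 - s) * mpow σ s).trace.re = Z s := by
    intro s
    rw [hmU, hmV, hoeff_trace_mpow, hZ, ← Fintype.sum_prod_type']
    simp only [Real.exp_add, hw]
  have hρm : mpow ρ 1 = ρ := by rw [hmU]; conv_rhs => rw [hAU]
                                simp
  have hσm : mpow σ 1 = σ := by rw [hmV]; conv_rhs => rw [hBV]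
                                simp
  have hZ0 : Z 0 = 1 := by
    rw [← hZeq, sub_zero, hρm, hmV]; simp [hV, hρ1]
  have hZ1 : Z 1 = 1 := by
    rw [← hZeq, sub_self, hσm, hmU]; simp [hU, hσ1]
  have hZpos : ∀ s, 0 < Z s := by
    intro s
    have hnn : ∀ k ∈ Finset.univ, 0 ≤ w k * Real.exp ((1-s) * l k.1 + s * u k.2) :=
      fun k _ => mul_nonneg (hw0 k) (Real.exp_pos _).le
    refine lt_of_le_of_ne (Finset.sum_nonneg hnn) fun h => ?_
    have h2 := (Finset.sum_eq_zero_iff_of_nonneg hnn).1 h.symm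
    have h3 : Z 0 = 0 := by
      refine Finset.sum_eq_zero fun k hk => ?_
      have := (mul_eq_zero.1 (h2 k hk)).resolve_right (Real.exp_pos _).ne'
      rw [this, zero_mul]
    rw [hZ0] at h3; exact one_ne_zero h3
  have hφ : ∀ s, qphi ρ σ s = Real.log (Z s) := fun s => by rw [qphi, hZeq]
  have hcd : ContDiff ℝ 1 (fun s => Real.log (Z s)) := by
    apply ContDiff.log
    · simp only [hZ]; fun_prop
    · exact fun s => (hZpos s).ne'
  have hbr : b r = ⨆ s : Set.Ico (0 : ℝ) 1, (-(s : ℝ) * r - Real.log (Z s)) / (1 - (s : ℝ)) := by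
    rw [hb]; simp only [hφ]
  refine le_of_forall_pos_le_add fun ε hε => ?_
  obtain ⟨s, hs0, hs1, hD, hE⟩ := hoeff_opt (fun s => Real.log (Z s)) hcd (by simp [hZ0])
    (by simp [hZ1]) r hr1 ε hε
  rw [← hbr] at hE
  have hder := ((hcd.differentiable (by simp)) s).hasDerivAt
  set m : ℝ := -deriv (fun s => Real.log (Z s)) s with hm
  have hder' : HasDerivAt (fun s => Real.log (Z s)) (-m) s := by rw [hm, neg_neg]; exact hder
  have hdm : deriv (fun s => Real.log (Z s)) s = -m := by rw [hm, neg_neg]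
  rw [hdm] at hD hE
  set F := Real.log (Z s) with hF
  -- choice of the slack
  obtain ⟨η, hη, hη1, hη2⟩ : ∃ η > 0, 2 * η ≤ F + s * m + b r + ε ∧
      2 * η ≤ r - (1 - s) * m + F := by
    refine ⟨min ((F + s * m + b r + ε) / 2) ((r - (1 - s) * m + F) / 2), ?_, ?_, ?_⟩
    · exact lt_min (by linarith) (by linarith)
    · linarith [min_le_left ((F + s * m + b r + ε) / 2) ((r - (1 - s) * m + F) / 2)]
    · linarith [min_le_right ((F + s * m + b r + ε) / 2) ((r - (1 - s) * m + F) / 2)]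
  -- extract the bound on the second kind error
  obtain ⟨a, ha, haη⟩ : ∃ a, (∀ᶠ n : ℕ in atTop,
      (1 / (n : ℝ)) * Real.log (((tensorPow σ n * T n).trace).re) ≤ a) ∧ a < -r + η / 2 := by
    rw [limsup_eq] at hβ
    have hne : {a : ℝ | ∀ᶠ n : ℕ in atTop,
        (1 / (n : ℝ)) * Real.log (((tensorPow σ n * T n).trace).re) ≤ a}.Nonempty := by
      by_contra hcon
      rw [Set.not_nonempty_iff_eq_empty] at hcon
      rw [hcon, Real.sInf_empty] at hβ
      linarith
    obtain ⟨a, h1, h2⟩ := exists_lt_of_csInf_lt hne (lt_of_le_of_lt hβ (show -r < -r + η/2 by linarith))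
    exact ⟨a, h1, h2⟩
  have hdecay : ∀ᶠ n : ℕ in atTop, Real.exp (-(η/2)) ^ n ≤ 1/8 := by
    have h := tendsto_pow_atTop_nhds_zero_of_lt_one (Real.exp_pos (-(η/2))).le
      (Real.exp_lt_one_iff.2 (by linarith))
    exact h.eventually_le_const (by norm_num)
  have hmin := hoeff_class w (fun k => l k.1) (fun k => u k.2) hw0 Z (fun _ => rfl) hZpos s hs0.le
    hs1.le m hder' η hη
  have hlower : ∀ᶠ n : ℕ in atTop, -(b r) - ε ≤
      (1 / (n : ℝ)) * Real.log (((tensorPow ρ n * (1 - T n)).trace).re) := by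
    filter_upwards [ha, hdecay, hmin, eventually_gt_atTop 0] with n hn1 hn2 hn3 hn0
    have hn0' : (0 : ℝ) < n := by exact_mod_cast hn0
    have hβn : ((tensorPow σ n * T n).trace).re ≤ Real.exp (n * a) := by
      rcases le_or_gt ((tensorPow σ n * T n).trace).re 0 with h | h
      · exact h.trans (Real.exp_pos _).le
      · rw [← Real.log_le_iff_le_exp h]
        rw [one_div, inv_mul_le_iff₀ hn0'] at hn1
        exact hn1
    have hkey := hoeff_min ρ σ U V l u hAU hBV hU hV n (T n) (hT n).1 (hT n).2
      (Real.exp (n * m)) (Real.exp_pos _).le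
    set α := ((tensorPow ρ n * (1 - T n)).trace).re
    rw [← Real.exp_nat_mul] at hn2
    set A := F + s * m - η with hA
    have h1 : Real.exp (n * m) * ((tensorPow σ n * T n).trace).re ≤ (1/8) * Real.exp (n * A) := by
      calc _ ≤ Real.exp (n * m) * Real.exp (n * a) :=
            mul_le_mul_of_nonneg_left hβn (Real.exp_pos _).le
        _ = Real.exp (n * (m + a)) := by rw [← Real.exp_add]; congr 1; ring
        _ ≤ Real.exp (n * (-(η/2)) + n * A) := by
            apply Real.exp_le_exp.2
            rw [← mul_add]
            apply mul_le_mul_of_nonneg_left _ hn0'.le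
            rw [hA]; linarith
        _ ≤ _ := by
            rw [Real.exp_add]
            exact mul_le_mul_of_nonneg_right hn2 (Real.exp_pos _).le
    have h2 : (1/8) * Real.exp (n * A) ≤ α := by
      have : (1/2) * ((1/2) * Real.exp (n * A)) ≤ α +
          Real.exp (n * m) * ((tensorPow σ n * T n).trace).re :=
        le_trans (mul_le_mul_of_nonneg_left hn3 (by norm_num)) hkey
      linarith
    have h3 : Real.exp (n * (A - η)) ≤ α := by
      refine le_trans ?_ h2
      calc Real.exp (n * (A - η)) ≤ Real.exp (n * (-(η/2)) + n * A) := by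
            apply Real.exp_le_exp.2
            rw [← mul_add]
            apply mul_le_mul_of_nonneg_left _ hn0'.le
            linarith
        _ ≤ _ := by
            rw [Real.exp_add]
            exact mul_le_mul_of_nonneg_right hn2 (Real.exp_pos _).le
    have h4 : n * (A - η) ≤ Real.log α :=
      (Real.le_log_iff_exp_le ((Real.exp_pos _).trans_le h3)).2 h3
    rw [one_div, le_inv_mul_iff₀ hn0']
    refine le_trans (mul_le_mul_of_nonneg_left ?_ hn0'.le) h4
    rw [hA]; linarith
  have hcob : IsCoboundedUnder (· ≥ ·) atTop (fun n : ℕ =>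
      (1 / (n : ℝ)) * Real.log (((tensorPow ρ n * (1 - T n)).trace).re)) := by
    apply IsBoundedUnder.isCoboundedUnder_ge
    refine isBoundedUnder_of ⟨0, fun n => ?_⟩
    refine mul_nonpos_of_nonneg_of_nonpos (by positivity) (Real.log_nonpos ?_ ?_)
    · exact hoeff_trace_nonneg ρ hρ n _ _ (hT n).2 (hT n).1 (by abel)
    · have h1 := hoeff_trace_nonneg ρ hρ n _ _ (hT n).1 (hT n).2 (by abel)
      rw [Matrix.mul_sub, Matrix.trace_sub, Matrix.mul_one, hoeff_tp_trace, hρ1, one_pow,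
        Complex.sub_re, Complex.one_re]
      linarith
  have := le_liminf_of_le hcob hlower
  linarith
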